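/- Let g ∈ ℤ[x] be x²-divisible of degree d and let c ∈ ℚ. If |g_c^{n'}(c)| ≥ max{4L_g, |c|} for some n' ≥ 0, then for every n ≥ n' one has ln|g_c^n(c)| ≥ d^{n−n'} · ln(|g_c^{n'}(c)|/2). -/

import Mathlib

open Polynomial

/-- The `n`-th iterate of `g_c := g + c` applied to `0`, for `g ∈ ℤ[x]` and `c ∈ ℚ`. -/
noncomputable def gcIter (g : ℤ[X]) (c : ℚ) (n : ℕ) : ℚ :=
  (fun x : ℚ => (g.map (Int.castRingHom ℚ)).eval x + c)^[n] 0

/-- `g` is `x²`-divisible: degree at least 2 and zero constant and linear coefficients. -/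
def IsX2Divisible (g : ℤ[X]) : Prop :=
  2 ≤ g.natDegree ∧ g.coeff 0 = 0 ∧ g.coeff 1 = 0

/-- The length `L_g = 1 + ∑_{i=2}^{d-1} |u_i|/|u_d|` of an `x²`-divisible polynomial. -/
noncomputable def Lg (g : ℤ[X]) : ℝ :=
  1 + ∑ i ∈ Finset.Ico 2 g.natDegree, (|g.coeff i| : ℝ) / (|g.leadingCoeff| : ℝ)

/-- `S_g`: the set of `c ∈ ℚ` such that the sequence `{g_c^n(0)}_{n ≥ 1}` takes
infinitely many values. -/
def Sg (g : ℤ[X]) : Set ℚ :=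
  {c : ℚ | (Set.range fun n : ℕ => gcIter g c (n + 1)).Infinite}

/-- The numerator `A_n` of `g_c^{n+1}(0) = g_c^n(c) = A_n / B_n` in lowest terms. -/
noncomputable def An (g : ℤ[X]) (c : ℚ) (n : ℕ) : ℤ := (gcIter g c (n + 1)).num

/-- The (positive) denominator `B_n` of `g_c^{n+1}(0) = g_c^n(c) = A_n / B_n`
in lowest terms. -/
noncomputable def Bn (g : ℤ[X]) (c : ℚ) (n : ℕ) : ℕ := (gcIter g c (n + 1)).den

/-- For a natural number `a`, the factor `â = ∏_{p ∈ I(a)} p^{val_p(a)}`, where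
`I(a)` consists of the primes `p` with `val_p(a) > val_p(u_d)`. -/
noncomputable def hatB (g : ℤ[X]) (a : ℕ) : ℕ :=
  ∏ p ∈ a.primeFactors.filter
      (fun p => padicValInt p g.leadingCoeff < padicValNat p a),
    p ^ padicValNat p a

/-- `g` has rapidly increasing numerators on `S`: there is an integer `N > 0` such that
for every `c ∈ S` there is a finite set `J_c ⊆ ℕ` with `#J_c ≤ N` such that for every
`n ≥ 1` outside `J_c` one has `ln |A_n| > ∑_{p ∣ n} ln |A_{n/p}|`. -/
def RapidlyIncreasingNumerators (g : ℤ[X]) (S : Set ℚ) : Prop :=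
  ∃ N : ℕ, 0 < N ∧ ∀ c ∈ S, ∃ J : Finset ℕ, J.card ≤ N ∧
    ∀ n : ℕ, 1 ≤ n → n ∉ J →
      (∑ p ∈ n.primeFactors, Real.log |(An g c (n / p) : ℝ)|) <
        Real.log |(An g c n : ℝ)|

/-- Evaluation of an `x²`-divisible polynomial, written out by coefficients. -/
theorem IsX2Divisible.eval_eq {g : ℤ[X]} (hg : IsX2Divisible g) (x : ℚ) :
    (g.map (Int.castRingHom ℚ)).eval x =
      ∑ i ∈ Finset.Ico 2 g.natDegree, (g.coeff i : ℚ) * x ^ i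
        + (g.leadingCoeff : ℚ) * x ^ g.natDegree := by
  obtain ⟨hd, h0, h1⟩ := hg
  rw [eval_map, eval₂_eq_sum_range, Finset.sum_range_succ,
    ← Finset.sum_range_add_sum_Ico _ hd]
  simp [Finset.sum_range_succ, h0, h1]

theorem gcIter_succ (g : ℤ[X]) (c : ℚ) (n : ℕ) :
    gcIter g c (n + 1) = (g.map (Int.castRingHom ℚ)).eval (gcIter g c n) + c := by
  simp only [gcIter, Function.iterate_succ_apply']

theorem one_le_Lg (g : ℤ[X]) : 1 ≤ Lg g :=
  le_add_of_nonneg_right (Finset.sum_nonneg fun _ _ => by positivity)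

/-- If `|x| ≥ 4 L_g` and `|x| ≥ |c|`, then `|g_c(x)| ≥ (3/4) |x|^d`. -/
theorem IsX2Divisible.three_quarters_mul_pow_le {g : ℤ[X]} (hg : IsX2Divisible g) {c x : ℚ}
    (hL : 4 * Lg g ≤ |(x : ℝ)|) (hc : |(c : ℝ)| ≤ |(x : ℝ)|) :
    3 / 4 * |(x : ℝ)| ^ g.natDegree ≤
      |(((g.map (Int.castRingHom ℚ)).eval x + c : ℚ) : ℝ)| := by
  have hd := hg.1
  have hlc : g.leadingCoeff ≠ 0 := by
    rw [Ne, leadingCoeff_eq_zero]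
    rintro rfl
    simp at hd
  have hlc1 : (1 : ℝ) ≤ |(g.leadingCoeff : ℝ)| := by
    exact_mod_cast Int.one_le_abs hlc
  have hx1 : 1 ≤ |(x : ℝ)| := by linarith [one_le_Lg g]
  obtain ⟨k, hk⟩ := Nat.exists_eq_add_of_le' (show 1 ≤ g.natDegree by lia)
  have hsum : |∑ i ∈ Finset.Ico 2 g.natDegree, (g.coeff i : ℝ) * (x : ℝ) ^ i| ≤
      |(g.leadingCoeff : ℝ)| * ((Lg g - 1) * |(x : ℝ)| ^ k) := by
    rw [Lg, add_sub_cancel_left, Finset.sum_mul, Finset.mul_sum]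
    refine (Finset.abs_sum_le_sum_abs _ _).trans (Finset.sum_le_sum fun i hi => ?_)
    have hik : i ≤ k := by
      have := (Finset.mem_Ico.mp hi).2
      lia
    have hcancel : |(g.leadingCoeff : ℝ)| *
        (|(g.coeff i : ℝ)| / |(g.leadingCoeff : ℝ)| * |(x : ℝ)| ^ k) =
          |(g.coeff i : ℝ)| * |(x : ℝ)| ^ k := by
      field_simp
    rw [hcancel, abs_mul, abs_pow]
    gcongr
  have hpow : |(x : ℝ)| ≤ |(x : ℝ)| ^ k := le_self_pow₀ hx1 (by lia)
  have hmain : 3 / 4 * |(x : ℝ)| ^ (k + 1) + |(x : ℝ)| ^ k ≤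
      |(x : ℝ)| ^ (k + 1) - (Lg g - 1) * |(x : ℝ)| ^ k := by
    have := mul_le_mul_of_nonneg_right hL (by positivity : 0 ≤ |(x : ℝ)| ^ k)
    rw [pow_succ]
    linarith
  have hscale : 3 / 4 * |(x : ℝ)| ^ (k + 1) + |(x : ℝ)| ^ k ≤
      |(g.leadingCoeff : ℝ)| * (|(x : ℝ)| ^ (k + 1) - (Lg g - 1) * |(x : ℝ)| ^ k) :=
    hmain.trans (le_mul_of_one_le_left (le_trans (by positivity) hmain) hlc1)
  rw [hg.eval_eq]
  push_cast
  set s := ∑ i ∈ Finset.Ico 2 g.natDegree, (g.coeff i : ℝ) * (x : ℝ) ^ i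
  set t := (g.leadingCoeff : ℝ) * (x : ℝ) ^ g.natDegree with ht
  have habs : |t| = |(g.leadingCoeff : ℝ)| * |(x : ℝ)| ^ (k + 1) := by
    rw [ht, abs_mul, abs_pow, hk]
  have htri : |t| ≤ |s + t + c| + |s| + |(c : ℝ)| := by
    calc |t| = |(s + t + c) - s - c| := by ring_nf
      _ ≤ |(s + t + c) - s| + |(c : ℝ)| := abs_sub _ _
      _ ≤ _ := by gcongr; exact abs_sub _ _
  rw [hk]
  linarith

/-- Once `|g_c^m(0)| ≥ max {4 L_g, |c|}`, this persists under iteration and the halved absolute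
values grow at least like iterated `d`-th powers. -/
theorem IsX2Divisible.gcIter_growth {g : ℤ[X]} (hg : IsX2Divisible g) {c : ℚ} {m : ℕ}
    (h : max (4 * Lg g) |(c : ℝ)| ≤ |(gcIter g c m : ℝ)|) (k : ℕ) :
    max (4 * Lg g) |(c : ℝ)| ≤ |(gcIter g c (m + k) : ℝ)| ∧
      (|(gcIter g c m : ℝ)| / 2) ^ g.natDegree ^ k ≤ |(gcIter g c (m + k) : ℝ)| / 2 := by
  induction k with
  | zero => simpa using h
  | succ k ih =>
    obtain ⟨hmax, hgrow⟩ := ih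
    have hL := (le_max_left _ _).trans hmax
    have hstep := hg.three_quarters_mul_pow_le hL ((le_max_right _ _).trans hmax)
    rw [← gcIter_succ] at hstep
    rw [← add_assoc]
    set y := |(gcIter g c (m + k) : ℝ)|
    have hy : 4 ≤ y := by linarith [one_le_Lg g]
    refine ⟨hmax.trans (le_trans ?_ hstep), ?_⟩
    · have := pow_le_pow_right₀ (by linarith : 1 ≤ y) hg.1
      nlinarith
    · have htwo : (2 : ℝ) ^ 2 ≤ 2 ^ g.natDegree := pow_le_pow_right₀ one_le_two hg.1
      have hsplit : y ^ g.natDegree = 2 ^ g.natDegree * (y / 2) ^ g.natDegree := by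
        rw [← mul_pow]
        ring_nf
      have hpos : 0 ≤ (y / 2) ^ g.natDegree := by positivity
      calc (|(gcIter g c m : ℝ)| / 2) ^ g.natDegree ^ (k + 1)
          = ((|(gcIter g c m : ℝ)| / 2) ^ g.natDegree ^ k) ^ g.natDegree := by
            rw [← pow_mul, pow_succ]
        _ ≤ (y / 2) ^ g.natDegree := by gcongr
        _ ≤ _ := by nlinarith

/-- Corollary 2.13: if `|g_c^{n'}(c)| ≥ max{4L_g, |c|}`, then for every `n ≥ n'` one has
`ln |g_c^n(c)| ≥ d^{n−n'} · ln (|g_c^{n'}(c)| / 2)`. -/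
theorem log_iterate_abs_growth (g : ℤ[X]) (hg : IsX2Divisible g) (c : ℚ) (n' : ℕ)
    (h : max (4 * Lg g) |(c : ℝ)| ≤ |(gcIter g c (n' + 1) : ℝ)|)
    (n : ℕ) (hn : n' ≤ n) :
    (g.natDegree : ℝ) ^ (n - n') * Real.log (|(gcIter g c (n' + 1) : ℝ)| / 2) ≤
      Real.log |(gcIter g c (n + 1) : ℝ)| := by
  have hpos : 0 < |(gcIter g c (n' + 1) : ℝ)| / 2 := by
    linarith [one_le_Lg g, (le_max_left _ _).trans h]
  obtain ⟨k, rfl⟩ := Nat.exists_eq_add_of_le hn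
  have hgrow := (hg.gcIter_growth h k).2
  rw [add_right_comm] at hgrow
  rw [Nat.add_sub_cancel_left, ← Nat.cast_pow, ← Real.log_pow]
  exact Real.log_le_log (by positivity) (hgrow.trans (half_le_self (abs_nonneg _)))
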